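/- arXiv:1904.06464 — 4 statements merged into one kernel-verified Lean document; each statement's English description precedes it below -/
import Mathlib

section
/- For any λ-graph bisystem (L⁻, L⁺) over finite alphabets Σ⁻, Σ⁺, there exist unique subshifts Λ_{L⁻} ⊆ (Σ⁻)^ℤ and Λ_{L⁺} ⊆ (Σ⁺)^ℤ whose sets of nonempty admissible words are exactly W_{L⁻} and W_{L⁺}, respectively. In particular W_{L⁺} (and likewise W_{L⁻}) is a factorial extendable language: every nonempty subword of a word in W_{L⁺} lies in W_{L⁺}, and for every word w ∈ W_{L⁺} there exist symbols α, β ∈ Σ⁺ with wα ∈ W_{L⁺} and βw ∈ W_{L⁺}. -/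
/-- The shift homeomorphism `σ` on the full shift: `(σ x) n = x (n+1)`. -/
def shiftMap {A : Type} (x : ℤ → A) : ℤ → A := fun n => x (n + 1)

/-- A subshift: a closed, shift-invariant subset of the full shift `A^ℤ`
(with `A` carrying the discrete topology and `A^ℤ` the product topology). -/
def IsSubshift {A : Type} [TopologicalSpace A] (Λ : Set (ℤ → A)) : Prop :=
  IsClosed Λ ∧ shiftMap '' Λ = Λ

/-- Replace the coordinates strictly between `k` and `l` of `x` by those of `μ`. -/
def splice {A : Type} (x : ℤ → A) (k l : ℤ) (μ : ℤ → A) : ℤ → A :=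
  fun n => if k < n ∧ n < l then μ n else x n

/-- `W_{k,l}(x)`: the set of words (recorded on the coordinates strictly between `k`
and `l`) which can be inserted between `x_{(-∞,k]}` and `x_{[l,∞)}` inside `Λ`. -/
def WSet {A : Type} (Λ : Set (ℤ → A)) (k l : ℤ) (x : ℤ → A) : Set (ℤ → A) :=
  { μ | splice x k l μ ∈ Λ }
/-- The set of (nonempty) admissible words of a subshift. -/
def lang {A : Type} (Λ : Set (ℤ → A)) : Set (List A) :=
  { w | w ≠ [] ∧ ∃ x ∈ Λ, ∃ i : ℤ, ∀ j : Fin w.length, w.get j = x (i + (j : ℕ)) }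
/-- The underlying data of a λ-graph bisystem `(L⁻, L⁺)` over alphabets `Sm, Sp`:
common vertex sets `V l`, upward edges `Em l = E⁻_{l+1,l}` (source in `V (l+1)`,
terminal in `V l`) labeled in `Sm`, and downward edges `Ep l = E⁺_{l,l+1}`
(source in `V l`, terminal in `V (l+1)`) labeled in `Sp`. -/
structure LGBSData (Sm Sp : Type) where
  V : ℕ → Type
  Em : ℕ → Type
  sm : ∀ l, Em l → V (l + 1)
  tm : ∀ l, Em l → V l
  lm : ∀ l, Em l → Sm
  Ep : ℕ → Type
  sp : ∀ l, Ep l → V l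
  tp : ∀ l, Ep l → V (l + 1)
  lp : ∀ l, Ep l → Sp

/-- The axioms making the data `L` a λ-graph bisystem: finite nonempty vertex sets,
finitely many edges, every vertex has the required incoming and outgoing edges,
`λ⁻` is right-resolving, `λ⁺` is left-resolving, and the local property holds. -/
structure IsLGBS {Sm Sp : Type} (L : LGBSData Sm Sp) : Prop where
  Vfin : ∀ l, Finite (L.V l)
  Vne : ∀ l, Nonempty (L.V l)
  Emfin : ∀ l, Finite (L.Em l)
  Epfin : ∀ l, Finite (L.Ep l)
  sm_surj : ∀ l, Function.Surjective (L.sm l)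
  tm_surj : ∀ l, Function.Surjective (L.tm l)
  sp_surj : ∀ l, Function.Surjective (L.sp l)
  tp_surj : ∀ l, Function.Surjective (L.tp l)
  right_resolving : ∀ l (e f : L.Em l), L.sm l e = L.sm l f → L.lm l e = L.lm l f → e = f
  left_resolving : ∀ l (e f : L.Ep l), L.tp l e = L.tp l f → L.lp l e = L.lp l f → e = f
  local_property : ∀ (l : ℕ) (u : L.V l) (v : L.V (l + 2)),
    ∃ φ : { p : L.Em l × L.Ep (l + 1) //
              L.tm l p.1 = u ∧ L.sm l p.1 = L.sp (l + 1) p.2 ∧ L.tp (l + 1) p.2 = v } ≃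
          { q : L.Ep l × L.Em (l + 1) //
              L.sp l q.1 = u ∧ L.tp l q.1 = L.tm (l + 1) q.2 ∧ L.sm (l + 1) q.2 = v },
      ∀ p, L.lm l p.1.1 = L.lm (l + 1) (φ p).1.2 ∧ L.lp (l + 1) p.1.2 = L.lp l (φ p).1.1
/-- Label words of paths in `L⁺` of length `k` starting at a vertex of level `n`. -/
def wplusAux {Sm Sp : Type} (L : LGBSData Sm Sp) : (n k : ℕ) → L.V n → Set (List Sp)
  | _, 0, _ => {[]}
  | n, k + 1, u =>
      { w | ∃ e : L.Ep n, L.sp n e = u ∧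
            ∃ w', w' ∈ wplusAux L (n + 1) k (L.tp n e) ∧ w = L.lp n e :: w' }

/-- `W_{L⁺}`: the set of nonempty label words of finite paths in `L⁺`. -/
def wPlus {Sm Sp : Type} (L : LGBSData Sm Sp) : Set (List Sp) :=
  { w | w ≠ [] ∧ ∃ (n : ℕ) (u : L.V n), w ∈ wplusAux L n w.length u }

/-- Label words of downward paths in `L⁻` of length `k` from a vertex of level `n + k`
down to level `n`, read from the topmost edge. -/
def wminusAux {Sm Sp : Type} (L : LGBSData Sm Sp) : (k n : ℕ) → L.V (n + k) → Set (List Sm)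
  | 0, _, _ => {[]}
  | k + 1, n, u =>
      { w | ∃ e : L.Em (n + k), L.sm (n + k) e = u ∧
            ∃ w', w' ∈ wminusAux L k n (L.tm (n + k) e) ∧ w = L.lm (n + k) e :: w' }

/-- `W_{L⁻}`: the set of nonempty label words of finite paths in `L⁻`. -/
def wMinus {Sm Sp : Type} (L : LGBSData Sm Sp) : Set (List Sm) :=
  { w | w ≠ [] ∧ ∃ (n : ℕ) (u : L.V (n + w.length)), w ∈ wminusAux L w.length n u }

/-- The word `x_i x_{i+1} … x_{i+k-1}`. -/
def window {A : Type} (x : ℤ → A) (i : ℤ) (k : ℕ) : List A :=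
  List.ofFn fun j : Fin k => x (i + (j : ℕ))

theorem mem_lang_iff {A : Type} {Λ : Set (ℤ → A)} {w : List A} :
    w ∈ lang Λ ↔ w ≠ [] ∧ ∃ x ∈ Λ, ∃ i : ℤ, window x i w.length = w := by
  have key (x : ℤ → A) (i : ℤ) :
      (∀ j : Fin w.length, w.get j = x (i + (j : ℕ))) ↔ window x i w.length = w := by
    constructor
    · intro h
      simp only [window, ← h]
      exact List.ofFn_get w
    · intro h j
      have hj : w[(j : ℕ)]? = (window x i w.length)[(j : ℕ)]? := by rw [h]
      simpa [window, List.getElem?_ofFn] using hj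
  simp only [lang, Set.mem_ofPred_eq, key]

theorem window_mem_lang {A : Type} {Λ : Set (ℤ → A)} {x : ℤ → A} (hx : x ∈ Λ) (i : ℤ) {k : ℕ}
    (hk : k ≠ 0) : window x i k ∈ lang Λ :=
  mem_lang_iff.2 ⟨by simpa [window] using hk, x, hx, i, by simp [window]⟩

theorem IsSubshift.translate_mem {A : Type} [TopologicalSpace A] {Λ : Set (ℤ → A)}
    (hΛ : IsSubshift Λ) {x : ℤ → A} (hx : x ∈ Λ) (m : ℤ) : (fun n => x (n + m)) ∈ Λ := by
  induction m using Int.induction_on with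
  | zero => simpa using hx
  | succ m ih =>
    rw [← hΛ.2]
    refine ⟨_, ih, ?_⟩
    funext n
    simp only [shiftMap]
    congr 1
    ring
  | pred m ih =>
    rw [← hΛ.2] at ih
    obtain ⟨y, hy, hyx⟩ := ih
    convert hy using 1
    funext n
    have h := congrFun hyx (n - 1)
    simp only [shiftMap, sub_add_cancel] at h
    rw [h]
    congr 1
    ring

/-- A subshift consists of all sequences whose windows are admissible words. -/
theorem IsSubshift.mem_iff {A : Type} [TopologicalSpace A] {Λ : Set (ℤ → A)}
    (hΛ : IsSubshift Λ) {x : ℤ → A} :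
    x ∈ Λ ↔ ∀ (i : ℤ) (k : ℕ), k ≠ 0 → window x i k ∈ lang Λ := by
  refine ⟨fun hx i k hk => window_mem_lang hx i hk, fun h => ?_⟩
  rw [← hΛ.1.closure_eq, mem_closure_iff]
  intro o ho hxo
  obtain ⟨I, u, hu, hI⟩ := isOpen_pi_iff.1 ho x hxo
  set N := I.sup Int.natAbs
  obtain ⟨-, y, hy, i, hi⟩ := mem_lang_iff.1 (h (-N) (2 * N + 1) (by omega))
  refine ⟨_, hI fun a ha => ?_, hΛ.translate_mem hy (i + N)⟩
  have haN : a.natAbs ≤ N := Finset.le_sup (f := Int.natAbs) ha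
  have hj := congrArg (fun l => l[(a + N).toNat]?) hi
  have hlt : (a + N).toNat < 2 * N + 1 := by omega
  have hcast : ((a + N).toNat : ℤ) = a + N := Int.toNat_of_nonneg (by omega)
  simp only [window, List.length_ofFn, List.getElem?_ofFn, hlt, dif_pos,
    Option.some.injEq, Fin.val_cast, hcast] at hj
  have hyx : y (a + (i + N)) = x a := by
    convert hj using 2 <;> ring
  simpa only [hyx] using (hu a ha).2

theorem isSubshift_setOf_window_mem {A : Type} [TopologicalSpace A] [DiscreteTopology A]
    (W : Set (List A)) :
    IsSubshift {x : ℤ → A | ∀ (i : ℤ) (k : ℕ), k ≠ 0 → window x i k ∈ W} := by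
  constructor
  · simp only [Set.ofPred_forall]
    refine isClosed_iInter fun i => isClosed_iInter fun k => isClosed_iInter fun _ => ?_
    have hc : Continuous fun (x : ℤ → A) (j : Fin k) => x (i + (j : ℕ)) := by fun_prop
    exact (isClosed_discrete {f : Fin k → A | List.ofFn f ∈ W}).preimage hc
  · ext x
    constructor
    · rintro ⟨y, hy, rfl⟩ i k hk
      convert hy (i + 1) k hk using 1
      simp only [window, shiftMap]
      congr 1
      funext j
      congr 1
      ring
    · intro hx
      refine ⟨fun n => x (n - 1), fun i k hk => ?_, by funext n; simp [shiftMap]⟩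
      convert hx (i - 1) k hk using 1
      simp only [window]
      congr 1
      funext j
      congr 1
      ring

/-- Every word of a factorial extendable language occurs in a bi-infinite sequence all of whose
windows lie in the language. -/
theorem exists_window_eq {A : Type} {W : Set (List A)}
    (hfac : ∀ w ∈ W, ∀ u : List A, u ≠ [] → u <:+: w → u ∈ W)
    (hright : ∀ w ∈ W, ∃ a : A, w ++ [a] ∈ W) (hleft : ∀ w ∈ W, ∃ b : A, b :: w ∈ W)
    {w : List A} (hw : w ∈ W) (hne : w ≠ []) :
    ∃ x : ℤ → A, (∀ (i : ℤ) (k : ℕ), k ≠ 0 → window x i k ∈ W) ∧ window x 0 w.length = w := by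
  have hext (v : W) : ∃ v' : W, ∃ a b : A, v'.1 = b :: (v.1 ++ [a]) := by
    obtain ⟨a, ha⟩ := hright _ v.2
    obtain ⟨b, hb⟩ := hleft _ ha
    exact ⟨⟨_, hb⟩, a, b, rfl⟩
  choose f hf using hext
  let s (n : ℕ) : List A := (f^[n] ⟨w, hw⟩).1
  have hs0 : s 0 = w := rfl
  have hsW (n : ℕ) : s n ∈ W := (f^[n] ⟨w, hw⟩).2
  have hsucc (n : ℕ) : ∃ a b : A, s (n + 1) = b :: (s n ++ [a]) := by
    simp only [s, Function.iterate_succ_apply']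
    exact hf _
  have hlen (n : ℕ) : (s n).length = w.length + 2 * n := by
    induction n with
    | zero => simp [hs0]
    | succ n ih =>
      obtain ⟨a, b, h⟩ := hsucc n
      rw [h]
      simp [ih]
      ring
  have hpos : 0 < w.length := List.length_pos_iff.2 hne
  have hstep (n d j : ℕ) (hj : j < (s n).length) : (s (n + d))[j + d]? = (s n)[j]? := by
    induction d with
    | zero => rfl
    | succ d ih =>
      obtain ⟨a, b, h⟩ := hsucc (n + d)
      rw [← Nat.add_assoc, ← Nat.add_assoc, h, List.getElem?_cons_succ,
        List.getElem?_append_left (by rw [hlen] at hj ⊢; omega), ih]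
  have hx (i : ℤ) : ∃ a : A, (s i.natAbs)[(i + i.natAbs).toNat]? = some a :=
    ⟨_, List.getElem?_eq_getElem (by rw [hlen]; omega)⟩
  choose x hx using hx
  have hxn (i : ℤ) (n j : ℕ) (hin : i.natAbs ≤ n) (hj : (j : ℤ) = i + n) :
      (s n)[j]? = some (x i) := by
    rw [← hx i, ← hstep i.natAbs (n - i.natAbs) _ (by rw [hlen]; omega)]
    congr 2 <;> omega
  have hxw (i : ℤ) (k n m : ℕ) (hm : (m : ℤ) = i + n) (hn : i.natAbs + k ≤ n) :
      window x i k = ((s n).drop m).take k := by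
    apply List.ext_getElem?
    intro j
    by_cases hjk : j < k
    · rw [List.getElem?_take_of_lt hjk, List.getElem?_drop,
        hxn (i + j) n (m + j) (by omega) (by push_cast; omega)]
      simp [window, hjk]
    · rw [List.getElem?_eq_none (by simp [window]; omega),
        List.getElem?_eq_none (by simp; omega)]
  refine ⟨x, fun i k hk => ?_, ?_⟩
  · refine hfac _ (hsW (i.natAbs + k)) _ (by simpa [window] using hk) ?_
    rw [hxw i k (i.natAbs + k) (i + (i.natAbs + k : ℕ)).toNat (by omega) le_rfl]
    exact (List.take_prefix _ _).isInfix.trans (List.drop_suffix _ _).isInfix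
  · rw [hxw 0 w.length w.length w.length (by simp) (by simp)]
    apply List.ext_getElem?
    intro j
    by_cases hj : j < w.length
    · rw [List.getElem?_take_of_lt hj, List.getElem?_drop, ← hs0]
      have := hstep 0 w.length j hj
      rw [Nat.zero_add] at this
      rw [hs0] at this ⊢
      rw [Nat.add_comm, this]
    · rw [List.getElem?_eq_none (by simp; omega), List.getElem?_eq_none (by omega)]

theorem existsUnique_isSubshift_lang_eq {A : Type} [TopologicalSpace A] [DiscreteTopology A]
    {W : Set (List A)} (hne : ∀ w ∈ W, w ≠ [])
    (hfac : ∀ w ∈ W, ∀ u : List A, u ≠ [] → u <:+: w → u ∈ W)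
    (hright : ∀ w ∈ W, ∃ a : A, w ++ [a] ∈ W) (hleft : ∀ w ∈ W, ∃ b : A, b :: w ∈ W) :
    ∃! Λ : Set (ℤ → A), IsSubshift Λ ∧ lang Λ = W := by
  refine ⟨_, ⟨isSubshift_setOf_window_mem W, ?_⟩, ?_⟩
  · ext w
    rw [mem_lang_iff]
    constructor
    · rintro ⟨hw, x, hx, i, hi⟩
      rw [← hi]
      exact hx i _ (by simpa using hw)
    · intro hw
      obtain ⟨x, hx, hxw⟩ := exists_window_eq hfac hright hleft hw (hne w hw)
      exact ⟨hne w hw, x, hx, 0, hxw⟩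
  · rintro Λ ⟨hΛ, rfl⟩
    ext x
    exact hΛ.mem_iff

/-- `IsPlusWord L w n u`: the word `w` labels a path of `L⁺` starting at `u ∈ V n`. -/
def IsPlusWord {Sm Sp : Type} (L : LGBSData Sm Sp) : List Sp → (n : ℕ) → L.V n → Prop
  | [], _, _ => True
  | a :: w, n, u => ∃ e : L.Ep n, L.sp n e = u ∧ L.lp n e = a ∧ IsPlusWord L w (n + 1) (L.tp n e)

/-- `IsMinusWord L w m u`: the word `w` labels a path of `L⁻` starting at `u ∈ V m`. -/
def IsMinusWord {Sm Sp : Type} (L : LGBSData Sm Sp) : List Sm → (m : ℕ) → L.V m → Prop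
  | [], _, _ => True
  | _ :: _, 0, _ => False
  | a :: w, m + 1, u => ∃ e : L.Em m, L.sm m e = u ∧ L.lm m e = a ∧ IsMinusWord L w m (L.tm m e)

section

variable {Sm Sp : Type} {L : LGBSData Sm Sp}

theorem mem_wplusAux_iff {w : List Sp} {n : ℕ} {u : L.V n} :
    w ∈ wplusAux L n w.length u ↔ IsPlusWord L w n u := by
  induction w generalizing n with
  | nil => simp [wplusAux, IsPlusWord]
  | cons a w ih =>
    simp only [List.length_cons, wplusAux, IsPlusWord, Set.mem_ofPred_eq]
    constructor
    · rintro ⟨e, he, w', hw', h⟩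
      obtain ⟨rfl, rfl⟩ := List.cons_eq_cons.1 h
      exact ⟨e, he, rfl, ih.1 hw'⟩
    · rintro ⟨e, he, rfl, hw⟩
      exact ⟨e, he, w, ih.2 hw, rfl⟩

theorem mem_wPlus_iff {w : List Sp} :
    w ∈ wPlus L ↔ w ≠ [] ∧ ∃ (n : ℕ) (u : L.V n), IsPlusWord L w n u := by
  simp only [wPlus, Set.mem_ofPred_eq, mem_wplusAux_iff]

theorem mem_wminusAux_iff {w : List Sm} {n : ℕ} {u : L.V (n + w.length)} :
    w ∈ wminusAux L w.length n u ↔ IsMinusWord L w (n + w.length) u := by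
  induction w with
  | nil => simp [wminusAux, IsMinusWord]
  | cons a w ih =>
    change (∃ e : L.Em (n + w.length), L.sm (n + w.length) e = u ∧
      ∃ w', w' ∈ wminusAux L w.length n (L.tm (n + w.length) e) ∧
        a :: w = L.lm (n + w.length) e :: w') ↔
      ∃ e : L.Em (n + w.length), L.sm (n + w.length) e = u ∧ L.lm (n + w.length) e = a ∧
        IsMinusWord L w (n + w.length) (L.tm (n + w.length) e)
    constructor
    · rintro ⟨e, he, w', hw', h⟩
      obtain ⟨rfl, rfl⟩ := List.cons_eq_cons.1 h
      exact ⟨e, he, rfl, ih.1 hw'⟩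
    · rintro ⟨e, he, rfl, hw⟩
      exact ⟨e, he, w, ih.2 hw, rfl⟩

theorem IsMinusWord.length_le {w : List Sm} {m : ℕ} {u : L.V m} (h : IsMinusWord L w m u) :
    w.length ≤ m := by
  induction w generalizing m with
  | nil => simp
  | cons a w ih =>
    cases m with
    | zero => exact h.elim
    | succ m =>
      obtain ⟨e, -, -, hw⟩ := h
      simpa using ih hw

theorem mem_wMinus_iff {w : List Sm} :
    w ∈ wMinus L ↔ w ≠ [] ∧ ∃ (m : ℕ) (u : L.V m), IsMinusWord L w m u := by
  simp only [wMinus, Set.mem_ofPred_eq, mem_wminusAux_iff]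
  refine and_congr_right fun _ => ⟨fun ⟨n, u, h⟩ => ⟨_, u, h⟩, fun ⟨m, u, h⟩ => ?_⟩
  obtain ⟨n, rfl⟩ := Nat.exists_eq_add_of_le' h.length_le
  exact ⟨n, u, h⟩

theorem IsPlusWord.of_append_left {v w : List Sp} {n : ℕ} {u : L.V n}
    (h : IsPlusWord L (v ++ w) n u) : IsPlusWord L v n u := by
  induction v generalizing n with
  | nil => trivial
  | cons a v ih =>
    obtain ⟨e, he, ha, hw⟩ := h
    exact ⟨e, he, ha, ih hw⟩

theorem IsPlusWord.of_append_right {v w : List Sp} {n : ℕ} {u : L.V n}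
    (h : IsPlusWord L (v ++ w) n u) : ∃ (n' : ℕ) (u' : L.V n'), IsPlusWord L w n' u' := by
  induction v generalizing n with
  | nil => exact ⟨n, u, h⟩
  | cons a v ih =>
    obtain ⟨e, -, -, hw⟩ := h
    exact ih hw

theorem IsMinusWord.of_append_left {v w : List Sm} {m : ℕ} {u : L.V m}
    (h : IsMinusWord L (v ++ w) m u) : IsMinusWord L v m u := by
  induction v generalizing m with
  | nil => cases m <;> trivial
  | cons a v ih =>
    cases m with
    | zero => exact h.elim
    | succ m =>
      obtain ⟨e, he, ha, hw⟩ := h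
      exact ⟨e, he, ha, ih hw⟩

theorem IsMinusWord.of_append_right {v w : List Sm} {m : ℕ} {u : L.V m}
    (h : IsMinusWord L (v ++ w) m u) : ∃ (m' : ℕ) (u' : L.V m'), IsMinusWord L w m' u' := by
  induction v generalizing m with
  | nil => exact ⟨m, u, h⟩
  | cons a v ih =>
    cases m with
    | zero => exact h.elim
    | succ m =>
      obtain ⟨e, -, -, hw⟩ := h
      exact ih hw

theorem IsPlusWord.exists_append (hL : IsLGBS L) {w : List Sp} {n : ℕ} {u : L.V n}
    (h : IsPlusWord L w n u) : ∃ a : Sp, IsPlusWord L (w ++ [a]) n u := by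
  induction w generalizing n with
  | nil =>
    obtain ⟨e, he⟩ := hL.sp_surj n u
    exact ⟨L.lp n e, e, he, rfl, trivial⟩
  | cons b w ih =>
    obtain ⟨e, he, hb, hw⟩ := h
    obtain ⟨a, ha⟩ := ih hw
    exact ⟨a, e, he, hb, ha⟩

theorem IsMinusWord.exists_append (hL : IsLGBS L) {w : List Sm} {m : ℕ} {u : L.V m}
    (h : IsMinusWord L w m u) (hm : w.length < m) : ∃ a : Sm, IsMinusWord L (w ++ [a]) m u := by
  induction w generalizing m with
  | nil =>
    obtain ⟨m, rfl⟩ := Nat.exists_eq_add_one_of_ne_zero hm.ne'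
    obtain ⟨e, he⟩ := hL.sm_surj m u
    exact ⟨L.lm m e, e, he, rfl, by cases m <;> trivial⟩
  | cons b w ih =>
    cases m with
    | zero => exact h.elim
    | succ m =>
      obtain ⟨e, he, hb, hw⟩ := h
      obtain ⟨a, ha⟩ := ih hw (by simpa using hm)
      exact ⟨a, e, he, hb, ha⟩

/-- By the local property, a path of `L⁺` can be moved one level down along an edge of `L⁻`. -/
theorem IsPlusWord.exists_succ (hL : IsLGBS L) {w : List Sp} {n : ℕ} {u : L.V n}
    (h : IsPlusWord L w n u) :
    ∃ e : L.Em n, L.tm n e = u ∧ IsPlusWord L w (n + 1) (L.sm n e) := by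
  induction w generalizing n with
  | nil =>
    obtain ⟨e, he⟩ := hL.tm_surj n u
    exact ⟨e, he, trivial⟩
  | cons a w ih =>
    obtain ⟨f, hf, ha, hw⟩ := h
    obtain ⟨g, hg, hgw⟩ := ih hw
    obtain ⟨φ, hφ⟩ := hL.local_property n u (L.sm (n + 1) g)
    obtain ⟨p, hp⟩ := φ.surjective ⟨(f, g), hf, hg.symm, rfl⟩
    have hlab := (hφ p).2
    rw [hp] at hlab
    obtain ⟨h₁, h₂, h₃⟩ := p.2
    refine ⟨p.1.1, h₁, p.1.2, h₂.symm, hlab.trans ha, ?_⟩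
    rw [h₃]
    exact hgw

/-- By the local property, a path of `L⁻` can be moved one level down along an edge of `L⁺`. -/
theorem IsMinusWord.succ (hL : IsLGBS L) {w : List Sm} {m : ℕ} {e : L.Ep m}
    (h : IsMinusWord L w m (L.sp m e)) : IsMinusWord L w (m + 1) (L.tp m e) := by
  induction w generalizing m with
  | nil => trivial
  | cons a w ih =>
    cases m with
    | zero => exact h.elim
    | succ m =>
      obtain ⟨f, hf, ha, hw⟩ := h
      obtain ⟨φ, hφ⟩ := hL.local_property m (L.tm m f) (L.tp (m + 1) e)
      have hlab := (hφ ⟨(f, e), rfl, hf, rfl⟩).1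
      obtain ⟨h₁, h₂, h₃⟩ := (φ ⟨(f, e), rfl, hf, rfl⟩).2
      refine ⟨_, h₃, hlab.symm.trans ha, ?_⟩
      rw [← h₂]
      rw [← h₁] at hw
      exact ih hw

theorem wPlus_factorial : ∀ w ∈ wPlus L, ∀ u : List Sp, u ≠ [] → u <:+: w → u ∈ wPlus L := by
  rintro _ hw u hu ⟨s, t, rfl⟩
  obtain ⟨-, n, v, h⟩ := mem_wPlus_iff.1 hw
  exact mem_wPlus_iff.2 ⟨hu, h.of_append_left.of_append_right⟩

theorem wMinus_factorial : ∀ w ∈ wMinus L, ∀ u : List Sm, u ≠ [] → u <:+: w → u ∈ wMinus L := by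
  rintro _ hw u hu ⟨s, t, rfl⟩
  obtain ⟨-, n, v, h⟩ := mem_wMinus_iff.1 hw
  exact mem_wMinus_iff.2 ⟨hu, h.of_append_left.of_append_right⟩

theorem wPlus_right_extendable (hL : IsLGBS L) : ∀ w ∈ wPlus L, ∃ a : Sp, w ++ [a] ∈ wPlus L := by
  intro w hw
  obtain ⟨-, n, u, h⟩ := mem_wPlus_iff.1 hw
  obtain ⟨a, ha⟩ := h.exists_append hL
  exact ⟨a, mem_wPlus_iff.2 ⟨by simp, n, u, ha⟩⟩

theorem wPlus_left_extendable (hL : IsLGBS L) : ∀ w ∈ wPlus L, ∃ b : Sp, b :: w ∈ wPlus L := by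
  intro w hw
  obtain ⟨-, n, u, h⟩ := mem_wPlus_iff.1 hw
  obtain ⟨e, -, he⟩ := h.exists_succ hL
  obtain ⟨f, hf⟩ := hL.tp_surj n (L.sm n e)
  exact ⟨L.lp n f, mem_wPlus_iff.2 ⟨by simp, n, L.sp n f, f, rfl, rfl, hf ▸ he⟩⟩

theorem wMinus_right_extendable (hL : IsLGBS L) :
    ∀ w ∈ wMinus L, ∃ a : Sm, w ++ [a] ∈ wMinus L := by
  intro w hw
  obtain ⟨-, m, u, h⟩ := mem_wMinus_iff.1 hw
  obtain ⟨e, rfl⟩ := hL.sp_surj m u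
  obtain ⟨a, ha⟩ := (h.succ hL).exists_append hL (Nat.lt_succ_of_le h.length_le)
  exact ⟨a, mem_wMinus_iff.2 ⟨by simp, m + 1, _, ha⟩⟩

theorem wMinus_left_extendable (hL : IsLGBS L) :
    ∀ w ∈ wMinus L, ∃ b : Sm, b :: w ∈ wMinus L := by
  intro w hw
  obtain ⟨-, m, u, h⟩ := mem_wMinus_iff.1 hw
  obtain ⟨e, rfl⟩ := hL.tm_surj m u
  exact ⟨L.lm m e, mem_wMinus_iff.2 ⟨by simp, m + 1, L.sm m e, e, rfl, rfl, h⟩⟩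

end

/-- any λ-graph bisystem presents a unique pair of subshifts, whose
admissible words are exactly the words of the two labeled Bratteli diagrams; in
particular the word sets are factorial extendable languages. -/
theorem stmt_0 {Sm Sp : Type} [Finite Sm] [Finite Sp]
    [TopologicalSpace Sm] [DiscreteTopology Sm] [TopologicalSpace Sp] [DiscreteTopology Sp]
    (L : LGBSData Sm Sp) (hL : IsLGBS L) :
    (∃! Λ : Set (ℤ → Sm), IsSubshift Λ ∧ lang Λ = wMinus L) ∧
    (∃! Λ : Set (ℤ → Sp), IsSubshift Λ ∧ lang Λ = wPlus L) ∧
    (∀ w ∈ wPlus L, ∀ u : List Sp, u ≠ [] → u <:+: w → u ∈ wPlus L) ∧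
    (∀ w ∈ wPlus L, ∃ α : Sp, w ++ [α] ∈ wPlus L) ∧
    (∀ w ∈ wPlus L, ∃ β : Sp, β :: w ∈ wPlus L) ∧
    (∀ w ∈ wMinus L, ∀ u : List Sm, u ≠ [] → u <:+: w → u ∈ wMinus L) ∧
    (∀ w ∈ wMinus L, ∃ α : Sm, w ++ [α] ∈ wMinus L) ∧
    (∀ w ∈ wMinus L, ∃ β : Sm, β :: w ∈ wMinus L) := by
  exact ⟨existsUnique_isSubshift_lang_eq (fun w hw => hw.1) wMinus_factorial
      (wMinus_right_extendable hL) (wMinus_left_extendable hL),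
    existsUnique_isSubshift_lang_eq (fun w hw => hw.1) wPlus_factorial
      (wPlus_right_extendable hL) (wPlus_left_extendable hL),
    wPlus_factorial, wPlus_right_extendable hL, wPlus_left_extendable hL,
    wMinus_factorial, wMinus_right_extendable hL, wMinus_left_extendable hL⟩
end

section
/- Let Λ be a subshift over a finite alphabet Σ and let k < l be integers. (i) Suppose x, z ∈ Λ satisfy W_{k,l}(x) = W_{k,l}(z), and α ∈ Σ and words μ, ν ∈ Σ^{l-k-2} satisfy μα ∈ W_{k,l}(x) and να ∈ W_{k,l}(z). Then W_{k,l-1}(x(μ,α)) = W_{k,l-1}(z(ν,α)), where x(μ,α) denotes the point (…, x_{k-1}, x_k, μ, α, x_l, x_{l+1}, …) ∈ Λ obtained by inserting μα between x_{(-∞,k]} and x_{[l,∞)}. (ii) Symmetrically, if β ∈ Σ and μ, ν ∈ Σ^{l-k-2} satisfy βμ ∈ W_{k,l}(x) and βν ∈ W_{k,l}(z), then W_{k+1,l}(x(β,μ)) = W_{k+1,l}(z(β,ν)), where x(β,μ) = (…, x_{k-1}, x_k, β, μ, x_l, x_{l+1}, …). -/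
theorem splice_congr {A : Type} (x : ℤ → A) {k l : ℤ} {μ ν : ℤ → A}
    (h : ∀ n, k < n → n < l → μ n = ν n) : splice x k l μ = splice x k l ν := by
  funext n
  unfold splice
  split_ifs with hn
  · exact h n hn.1 hn.2
  · rfl

theorem splice_splice {A : Type} (x : ℤ → A) {k l k' l' : ℤ} (hk : k ≤ k') (hl : l' ≤ l)
    (μ ν : ℤ → A) :
    splice (splice x k l μ) k' l' ν = splice x k l (splice μ k' l' ν) := by
  funext n
  unfold splice
  grind

/-- Central equivalence on a window passes to a smaller window after inserting words which agree
on the part of the window that is no longer free. -/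
theorem WSet_splice_eq {A : Type} {Λ : Set (ℤ → A)} {k l k' l' : ℤ} {x z : ℤ → A}
    (hW : WSet Λ k l x = WSet Λ k l z) (hk : k ≤ k') (hl : l' ≤ l) {μ ν : ℤ → A}
    (h : ∀ n, k < n → n < l → ¬(k' < n ∧ n < l') → μ n = ν n) :
    WSet Λ k' l' (splice x k l μ) = WSet Λ k' l' (splice z k l ν) := by
  ext w
  have hw : splice z k l (splice μ k' l' w) = splice z k l (splice ν k' l' w) := by
    refine splice_congr z fun n hkn hnl => ?_
    unfold splice
    split_ifs with hn
    · rfl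
    · exact h n hkn hnl hn
  have := Set.ext_iff.mp hW (splice μ k' l' w)
  simp only [WSet, Set.mem_ofPred_eq] at this ⊢
  rw [splice_splice x hk hl, splice_splice z hk hl, this, hw]

/-- well-definedness of the insertion operations on central classes. -/
theorem stmt_1 {A : Type} [TopologicalSpace A] [DiscreteTopology A]
    (Λ : Set (ℤ → A)) (hΛ : IsSubshift Λ) (k l : ℤ) (hkl : k + 1 < l)
    (x z : ℤ → A) (hx : x ∈ Λ) (hz : z ∈ Λ)
    (hW : WSet Λ k l x = WSet Λ k l z) :
    (∀ (α : A) (μ ν : ℤ → A),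
      (fun n => if n = l - 1 then α else μ n) ∈ WSet Λ k l x →
      (fun n => if n = l - 1 then α else ν n) ∈ WSet Λ k l z →
      WSet Λ k (l - 1) (splice x k l (fun n => if n = l - 1 then α else μ n)) =
        WSet Λ k (l - 1) (splice z k l (fun n => if n = l - 1 then α else ν n))) ∧
    (∀ (β : A) (μ ν : ℤ → A),
      (fun n => if n = k + 1 then β else μ n) ∈ WSet Λ k l x →
      (fun n => if n = k + 1 then β else ν n) ∈ WSet Λ k l z →
      WSet Λ (k + 1) l (splice x k l (fun n => if n = k + 1 then β else μ n)) =
        WSet Λ (k + 1) l (splice z k l (fun n => if n = k + 1 then β else ν n))) := by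
  refine ⟨fun α μ ν _ _ => WSet_splice_eq hW le_rfl (by omega) fun n hkn hnl hn => ?_,
    fun β μ ν _ _ => WSet_splice_eq hW (by omega) le_rfl fun n hkn hnl hn => ?_⟩
  · have : n = l - 1 := by omega
    simp [this]
  · have : n = k + 1 := by omega
    simp [this]
end

section
/- For every nonempty subshift Λ over a finite alphabet Σ, the canonical pair (L_Λ⁻, L_Λ⁺) built from the central equivalence classes of Λ is a λ-graph bisystem over the common alphabet Σ satisfying FPCC, and it presents Λ: the set of label sequences of finite paths in L_Λ⁺ (equivalently in L_Λ⁻) coincides with the set B_*(Λ) of nonempty admissible words of Λ. -/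
/-- The follower set `F(u)` of a vertex `u ∈ V_l` in `L⁻`: label words of downward
paths in `L⁻` from `u` to the top level `V_0`. -/
def follower {Sm Sp : Type} (L : LGBSData Sm Sp) : (l : ℕ) → L.V l → Set (List Sm)
  | 0, _ => {[]}
  | l + 1, u =>
      { w | ∃ e : L.Em l, L.sm l e = u ∧
            ∃ w', w' ∈ follower L l (L.tm l e) ∧ w = L.lm l e :: w' }

/-- The predecessor set `P(u)` of a vertex `u ∈ V_l` in `L⁺`: label words of paths
in `L⁺` from the top level `V_0` down to `u`. -/
def predecessor {Sm Sp : Type} (L : LGBSData Sm Sp) : (l : ℕ) → L.V l → Set (List Sp)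
  | 0, _ => {[]}
  | l + 1, u =>
      { w | ∃ e : L.Ep l, L.tp l e = u ∧
            ∃ w', w' ∈ predecessor L l (L.sp l e) ∧ w = w' ++ [L.lp l e] }

/-- FPCC (Follower-Predecessor Compatibility Condition) for a λ-graph bisystem over a
common alphabet: it is standard (`V 0` a singleton) and `F(u) = P(u)` for every vertex. -/
def LGBSData.FPCC {S : Type} (L : LGBSData S S) : Prop :=
  (Nonempty (L.V 0) ∧ Subsingleton (L.V 0)) ∧
  ∀ (l : ℕ) (u : L.V l), follower L l u = predecessor L l u
/-- The `(k,l)`-central equivalence relation on the points of `Λ`. -/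
def cSetoid {A : Type} (Λ : Set (ℤ → A)) (k l : ℤ) : Setoid ↥Λ where
  r x y := WSet Λ k l x.1 = WSet Λ k l y.1
  iseqv := ⟨fun _ => rfl, Eq.symm, Eq.trans⟩

/-- Powers of the shift: `(shiftZ t x) n = x (n + t)`. -/
def shiftZ {A : Type} (t : ℤ) (x : ℤ → A) : ℤ → A := fun n => x (n + t)

/-- The vertex set `V_l = Ω^c_{-l,1}` of the canonical λ-graph bisystem of `Λ`. -/
abbrev Vq {A : Type} (Λ : Set (ℤ → A)) (l : ℕ) : Type := Quotient (cSetoid Λ (-(l : ℤ)) 1)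

/-- The relation defining the labeled edges of the canonical `L_Λ⁻`: there is an edge
labeled `β` from the class `c'` (at level `l+1`) down to the class `c` (at level `l`)
iff `C' β ⊆ C`, i.e. inserting `β` (followed by a suitable word) just after
coordinate `-(l+1)` of a representative of `c'` produces a point of the class `c`. -/
def minusRel {A : Type} (Λ : Set (ℤ → A)) (l : ℕ) (β : A)
    (c' : Vq Λ (l + 1)) (c : Vq Λ l) : Prop :=
  ∃ y : ↥Λ, Quotient.mk (cSetoid Λ (-((l + 1 : ℕ) : ℤ)) 1) y = c' ∧
    ∃ (v : ℤ → A) (h : splice y.1 (-((l + 1 : ℕ) : ℤ)) 1 v ∈ Λ),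
      v (-(l : ℤ)) = β ∧
      Quotient.mk (cSetoid Λ (-(l : ℤ)) 1) ⟨splice y.1 (-((l + 1 : ℕ) : ℤ)) 1 v, h⟩ = c

/-- The relation defining the labeled edges of the canonical `L_Λ⁺`: there is an edge
labeled `α` from the class `c` (at level `l`) to the class `c'` (at level `l+1`) iff
`α C' ⊆ C`, i.e. (after the identification `Ω^c_{-(l+1),1} ≅ Ω^c_{-1,l+1}` given by
`σ^{-l}`) inserting a suitable word ending with `α` just before coordinate `l+1` of a
representative of `c'` produces (after shifting back by `σ^{l-1}`) a point of `c`. -/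
def plusRel {A : Type} (Λ : Set (ℤ → A)) (l : ℕ) (α : A)
    (c : Vq Λ l) (c' : Vq Λ (l + 1)) : Prop :=
  ∃ y : ↥Λ, Quotient.mk (cSetoid Λ (-((l + 1 : ℕ) : ℤ)) 1) y = c' ∧
    ∃ (v : ℤ → A) (h : splice (shiftZ (-(l : ℤ)) y.1) (-1) ((l : ℤ) + 1) v ∈ Λ),
      v (l : ℤ) = α ∧
      ∃ h2 : shiftZ ((l : ℤ) - 1) (splice (shiftZ (-(l : ℤ)) y.1) (-1) ((l : ℤ) + 1) v) ∈ Λ,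
        Quotient.mk (cSetoid Λ (-(l : ℤ)) 1)
          ⟨shiftZ ((l : ℤ) - 1) (splice (shiftZ (-(l : ℤ)) y.1) (-1) ((l : ℤ) + 1) v), h2⟩ = c

/-- The data of the canonical λ-graph bisystem `(L_Λ⁻, L_Λ⁺)` of a subshift `Λ`,
built from the central equivalence classes of `Λ`. -/
def canonicalLGBS {A : Type} (Λ : Set (ℤ → A)) : LGBSData A A where
  V := fun l => Vq Λ l
  Em := fun l => { p : Vq Λ (l + 1) × A × Vq Λ l // minusRel Λ l p.2.1 p.1 p.2.2 }
  sm := fun _ e => e.1.1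
  tm := fun _ e => e.1.2.2
  lm := fun _ e => e.1.2.1
  Ep := fun l => { p : Vq Λ l × A × Vq Λ (l + 1) // plusRel Λ l p.2.1 p.1 p.2.2 }
  sp := fun _ e => e.1.1
  tp := fun _ e => e.1.2.2
  lp := fun _ e => e.1.2.1

/-- Overwrite the coordinates of `x` from `i` on by the letters of the word `w`. -/
def overwrite {A : Type} (i : ℤ) (w : List A) (x : ℤ → A) : ℤ → A :=
  fun n => if n < i then x n else w[(n - i).toNat]?.getD (x n)

/-- The word of length `k` read in `x` from the coordinate `i` on. -/
def wordAt {A : Type} (i : ℤ) (k : ℕ) (x : ℤ → A) : List A :=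
  (List.range k).map fun j : ℕ => x (i + (j : ℤ))

/-- The words of length `l` which fit into the coordinates `1 - l, …, 0` of `x`. -/
def fittingWords {A : Type} (Λ : Set (ℤ → A)) (l : ℕ) (x : ℤ → A) : Set (List A) :=
  { w | w.length = l ∧ overwrite (1 - (l : ℤ)) w x ∈ Λ }

section words

variable {A : Type}

theorem length_wordAt (i : ℤ) (k : ℕ) (x : ℤ → A) : (wordAt i k x).length = k := by
  simp [wordAt]

theorem wordAt_succ (i : ℤ) (k : ℕ) (x : ℤ → A) :
    wordAt i (k + 1) x = x i :: wordAt (i + 1) k x := by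
  simp [wordAt, List.range_succ_eq_map, Function.comp_def, add_assoc, add_comm (1 : ℤ)]

theorem wordAt_succ_last (i : ℤ) (k : ℕ) (x : ℤ → A) :
    wordAt i (k + 1) x = wordAt i k x ++ [x (i + k)] := by
  simp [wordAt, List.range_succ]

theorem eq_wordAt {i : ℤ} {w : List A} {x : ℤ → A}
    (h : ∀ j : Fin w.length, w.get j = x (i + (j : ℕ))) : w = wordAt i w.length x := by
  apply List.ext_getElem
  · simp [wordAt]
  · intro j hj hj'
    simpa [wordAt] using h ⟨j, hj⟩

theorem overwrite_add (i : ℤ) (w : List A) (x : ℤ → A) (m : ℕ) :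
    overwrite i w x (i + m) = w[m]?.getD (x (i + m)) := by
  simp [overwrite]

theorem overwrite_of_lt {i n : ℤ} (h : n < i) (w : List A) (x : ℤ → A) :
    overwrite i w x n = x n := by
  simp [overwrite, h]

theorem overwrite_ext {i : ℤ} {w : List A} {x y : ℤ → A} (h₁ : ∀ n < i, y n = x n)
    (h₂ : ∀ m : ℕ, y (i + m) = w[m]?.getD (x (i + m))) : overwrite i w x = y := by
  funext n
  rcases lt_or_ge n i with h | h
  · rw [overwrite_of_lt h, h₁ n h]
  · obtain ⟨m, rfl⟩ := Int.le.dest h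
    rw [overwrite_add, h₂]

theorem splice_eq_overwrite (x v : ℤ → A) {i k l : ℤ} {m : ℕ} (hk : k + 1 = i) (hl : l = i + m) :
    splice x k l v = overwrite i (wordAt i m v) x := by
  refine (overwrite_ext (fun n hn => ?_) fun j => ?_).symm
  · rw [splice, if_neg (by omega)]
  · by_cases hj : j < m
    · rw [splice, if_pos (by omega)]
      simp [wordAt, hj]
    · rw [splice, if_neg (by omega)]
      simp [wordAt, hj]

theorem overwrite_wordAt (i : ℤ) (k : ℕ) (x : ℤ → A) : overwrite i (wordAt i k x) x = x := by
  refine overwrite_ext (fun n _ => rfl) fun m => ?_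
  by_cases hm : m < k <;> simp [wordAt, hm]

theorem wordAt_overwrite (i : ℤ) (w : List A) (x : ℤ → A) :
    wordAt i w.length (overwrite i w x) = w := by
  apply List.ext_getElem
  · simp [wordAt]
  · intro j hj hj'
    simp [wordAt, overwrite_add, hj']

theorem overwrite_overwrite_cons (i : ℤ) {μ ν : List A} (h : μ.length = ν.length) (β : A)
    (x : ℤ → A) : overwrite (i + 1) μ (overwrite i (β :: ν) x) = overwrite i (β :: μ) x := by
  refine overwrite_ext (fun n hn => ?_) fun m => ?_
  · rcases lt_or_ge n i with hi | hi
    · rw [overwrite_of_lt hi, overwrite_of_lt hi]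
    · obtain rfl : n = i + (0 : ℕ) := by push_cast; omega
      rw [overwrite_add, overwrite_add]
      simp
  · have e : i + 1 + (m : ℤ) = i + ((m + 1 : ℕ) : ℤ) := by push_cast; ring
    rw [e, overwrite_add, overwrite_add]
    by_cases hm : m < ν.length <;> simp [h, hm]

theorem overwrite_overwrite_append (i : ℤ) {μ ν : List A} (h : μ.length = ν.length) (α : A)
    (x : ℤ → A) : overwrite i μ (overwrite i (ν ++ [α]) x) = overwrite i (μ ++ [α]) x := by
  refine overwrite_ext (fun n hn => ?_) fun m => ?_
  · rw [overwrite_of_lt hn, overwrite_of_lt hn]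
  · rw [overwrite_add, overwrite_add]
    by_cases hm : m < ν.length
    · simp [List.getElem?_append, h, hm]
    · simp [List.getElem?_append, h, hm]

theorem overwrite_shiftZ (i t : ℤ) (w : List A) (x : ℤ → A) :
    overwrite i w (shiftZ t x) = shiftZ t (overwrite (i + t) w x) := by
  funext n
  simp [overwrite, shiftZ]

end words

section fitting

variable {A : Type} {Λ : Set (ℤ → A)}

theorem shiftZ_mem_iff (hΛ : shiftMap '' Λ = Λ) (t : ℤ) (x : ℤ → A) :
    shiftZ t x ∈ Λ ↔ x ∈ Λ := by
  have step (y : ℤ → A) : shiftMap y ∈ Λ ↔ y ∈ Λ := by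
    refine ⟨fun h => ?_, fun h => hΛ ▸ Set.mem_image_of_mem _ h⟩
    rw [← hΛ] at h
    obtain ⟨z, hz, hzy⟩ := h
    have : z = y := by
      funext n
      simpa [shiftMap] using congrFun hzy (n - 1)
    exact this ▸ hz
  have succ (s : ℤ) : shiftMap (shiftZ s x) = shiftZ (s + 1) x := by
    funext n
    simp only [shiftMap, shiftZ]
    congr 1
    ring
  induction t using Int.induction_on with
  | zero => rw [show shiftZ 0 x = x by funext n; simp [shiftZ]]
  | succ k ih => exact succ k ▸ (step _).trans ih
  | pred k ih =>
    rw [← step, succ, sub_add_cancel]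
    exact ih

theorem fittingWords_eq_iff (l : ℕ) (x y : ℤ → A) :
    WSet Λ (-(l : ℤ)) 1 x = WSet Λ (-(l : ℤ)) 1 y ↔ fittingWords Λ l x = fittingWords Λ l y := by
  have key (z v : ℤ → A) : splice z (-(l : ℤ)) 1 v =
      overwrite (1 - (l : ℤ)) (wordAt (1 - (l : ℤ)) l v) z :=
    splice_eq_overwrite z v (by ring) (by ring)
  constructor
  · intro h
    ext w
    refine and_congr_right fun hw => ?_
    subst hw
    have := Set.ext_iff.1 h (overwrite (1 - (w.length : ℤ)) w x)
    simpa only [WSet, Set.mem_ofPred_eq, key, wordAt_overwrite] using this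
  · intro h
    ext v
    have := Set.ext_iff.1 h (wordAt (1 - (l : ℤ)) l v)
    change splice x _ 1 v ∈ Λ ↔ splice y _ 1 v ∈ Λ
    simpa only [fittingWords, Set.mem_ofPred_eq, length_wordAt, true_and, ← key] using this

theorem mem_fittingWords_wordAt (l : ℕ) {x : ℤ → A} (hx : x ∈ Λ) :
    wordAt (1 - (l : ℤ)) l x ∈ fittingWords Λ l x :=
  ⟨length_wordAt _ _ _, by rwa [overwrite_wordAt]⟩

theorem fittingWords_overwrite_cons {l : ℕ} (β : A) {ν : List A} (hν : ν.length = l) (x : ℤ → A) :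
    fittingWords Λ l (overwrite (-(l : ℤ)) (β :: ν) x) =
      { μ | β :: μ ∈ fittingWords Λ (l + 1) x } := by
  ext μ
  simp only [fittingWords, Set.mem_ofPred_eq, List.length_cons, Nat.add_right_cancel_iff]
  refine and_congr_right fun hμ => ?_
  rw [show (1 : ℤ) - l = -l + 1 by ring, overwrite_overwrite_cons _ (hμ.trans hν.symm)]
  push_cast
  rw [show (1 : ℤ) - (l + 1) = -l by ring]

theorem fittingWords_overwrite_append (hΛ : shiftMap '' Λ = Λ) {l : ℕ} (α : A) {ν : List A}
    (hν : ν.length = l) (x : ℤ → A) :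
    fittingWords Λ l (shiftZ (-1) (overwrite (-(l : ℤ)) (ν ++ [α]) x)) =
      { μ | μ ++ [α] ∈ fittingWords Λ (l + 1) x } := by
  ext μ
  simp only [fittingWords, Set.mem_ofPred_eq, List.length_append, List.length_singleton,
    Nat.add_right_cancel_iff]
  refine and_congr_right fun hμ => ?_
  rw [overwrite_shiftZ, shiftZ_mem_iff hΛ, show (1 : ℤ) - l + -1 = -l by ring,
    overwrite_overwrite_append _ (hμ.trans hν.symm)]
  push_cast
  rw [show (1 : ℤ) - (l + 1) = -l by ring]

end fitting

section classes

variable {A : Type} {Λ : Set (ℤ → A)}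

/-- The class at level `l` of a point of `Λ`. -/
def vertexOf (l : ℕ) (x : ↥Λ) : Vq Λ l := Quotient.mk (cSetoid Λ (-(l : ℤ)) 1) x

/-- The words of length `l` which fit into the points of a class at level `l`. -/
def centralWords {l : ℕ} (c : Vq Λ l) : Set (List A) :=
  Quotient.lift (s := cSetoid Λ (-(l : ℤ)) 1) (fun x : ↥Λ => fittingWords Λ l x.1)
    (fun x y h => (fittingWords_eq_iff l x.1 y.1).1 h) c

theorem centralWords_vertexOf (l : ℕ) (x : ↥Λ) :
    centralWords (vertexOf l x) = fittingWords Λ l x.1 := rfl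

theorem exists_vertexOf {l : ℕ} (c : Vq Λ l) : ∃ x : ↥Λ, vertexOf l x = c :=
  Quotient.exists_rep c

theorem centralWords_injective (l : ℕ) :
    Function.Injective (centralWords : Vq Λ l → Set (List A)) := by
  intro c d h
  obtain ⟨x, rfl⟩ := exists_vertexOf c
  obtain ⟨y, rfl⟩ := exists_vertexOf d
  exact Quotient.sound (s := cSetoid Λ (-(l : ℤ)) 1) ((fittingWords_eq_iff l x.1 y.1).2 h)

theorem centralWords_nonempty {l : ℕ} (c : Vq Λ l) : (centralWords c).Nonempty := by
  obtain ⟨x, rfl⟩ := exists_vertexOf c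
  exact ⟨_, mem_fittingWords_wordAt l x.2⟩

theorem length_of_mem_centralWords {l : ℕ} {c : Vq Λ l} {w : List A} (h : w ∈ centralWords c) :
    w.length = l := by
  obtain ⟨x, rfl⟩ := exists_vertexOf c
  exact h.1

theorem centralWords_zero (c : Vq Λ 0) : centralWords c = {[]} := by
  refine (Set.Nonempty.subset_singleton_iff (centralWords_nonempty c)).1 fun w hw => ?_
  exact List.length_eq_zero_iff.1 (length_of_mem_centralWords hw)

theorem exists_wordAt_of_mem_centralWords {l : ℕ} {c : Vq Λ l} {w : List A}
    (h : w ∈ centralWords c) : ∃ x ∈ Λ, ∃ i : ℤ, w = wordAt i w.length x := by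
  obtain ⟨x, rfl⟩ := exists_vertexOf c
  exact ⟨_, h.2, _, (wordAt_overwrite _ w x.1).symm⟩

theorem minusRel_iff {l : ℕ} {β : A} {c' : Vq Λ (l + 1)} {c : Vq Λ l} :
    minusRel Λ l β c' c ↔ centralWords c = { μ | β :: μ ∈ centralWords c' } := by
  have key (z v : ℤ → A) : splice z (-((l + 1 : ℕ) : ℤ)) 1 v =
      overwrite (-(l : ℤ)) (v (-(l : ℤ)) :: wordAt (-(l : ℤ) + 1) l v) z := by
    rw [← wordAt_succ]
    exact splice_eq_overwrite z v (by push_cast; ring) (by push_cast; ring)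
  constructor
  · rintro ⟨y, rfl, v, h, rfl, rfl⟩
    change fittingWords Λ l (splice y.1 (-((l + 1 : ℕ) : ℤ)) 1 v) = _
    rw [key, fittingWords_overwrite_cons _ (length_wordAt _ _ _)]
    rfl
  · intro h
    obtain ⟨μ, hμ⟩ := centralWords_nonempty c
    have hl := length_of_mem_centralWords hμ
    rw [h] at hμ
    obtain ⟨y, rfl⟩ := exists_vertexOf c'
    have e : splice y.1 (-((l + 1 : ℕ) : ℤ)) 1 (overwrite (-(l : ℤ)) (β :: μ) y.1) =
        overwrite (-(l : ℤ)) (β :: μ) y.1 := by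
      subst hl
      rw [key, ← wordAt_succ]
      exact congrArg (fun w => overwrite _ w y.1) (wordAt_overwrite _ (β :: μ) y.1)
    have hm : overwrite (-(l : ℤ)) (β :: μ) y.1 ∈ Λ := by
      have := hμ.2
      push_cast at this
      rwa [show (1 : ℤ) - (l + 1) = -l by ring] at this
    refine ⟨y, rfl, overwrite (-(l : ℤ)) (β :: μ) y.1, by rwa [e], ?_,
      centralWords_injective l ?_⟩
    · simpa using overwrite_add (-(l : ℤ)) (β :: μ) y.1 0
    · rw [h]
      change fittingWords Λ l (splice y.1 _ 1 _) = _
      rw [e, fittingWords_overwrite_cons _ hl]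
      rfl

theorem plusRel_iff (hΛ : shiftMap '' Λ = Λ) {l : ℕ} {α : A} {c : Vq Λ l} {c' : Vq Λ (l + 1)} :
    plusRel Λ l α c c' ↔ centralWords c = { μ | μ ++ [α] ∈ centralWords c' } := by
  have key (z v : ℤ → A) : splice (shiftZ (-(l : ℤ)) z) (-1) ((l : ℤ) + 1) v =
      shiftZ (-(l : ℤ)) (overwrite (-(l : ℤ)) (wordAt 0 l v ++ [v l]) z) := by
    have h := wordAt_succ_last 0 l v
    rw [zero_add] at h
    rw [← h, splice_eq_overwrite (i := 0) (m := l + 1) _ v (by ring) (by push_cast; ring),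
      overwrite_shiftZ, zero_add]
  have shift (z : ℤ → A) : shiftZ ((l : ℤ) - 1) (shiftZ (-(l : ℤ)) z) = shiftZ (-1) z := by
    funext n
    simp only [shiftZ]
    congr 1
    ring
  constructor
  · rintro ⟨y, rfl, v, h, rfl, h2, rfl⟩
    change fittingWords Λ l (shiftZ ((l : ℤ) - 1)
      (splice (shiftZ (-(l : ℤ)) y.1) (-1) ((l : ℤ) + 1) v)) = _
    rw [key, shift, fittingWords_overwrite_append hΛ _ (length_wordAt _ _ _)]
    rfl
  · intro h
    obtain ⟨μ, hμ⟩ := centralWords_nonempty c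
    have hl := length_of_mem_centralWords hμ
    rw [h] at hμ
    obtain ⟨y, rfl⟩ := exists_vertexOf c'
    have hv : wordAt 0 l (overwrite 0 (μ ++ [α]) y.1) ++ [overwrite 0 (μ ++ [α]) y.1 l] =
        μ ++ [α] := by
      subst hl
      have h₁ := wordAt_succ_last 0 μ.length (overwrite 0 (μ ++ [α]) y.1)
      rw [zero_add] at h₁
      rw [← h₁]
      simpa using wordAt_overwrite 0 (μ ++ [α]) y.1
    have hm : overwrite (-(l : ℤ)) (μ ++ [α]) y.1 ∈ Λ := by
      have := hμ.2
      push_cast at this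
      rwa [show (1 : ℤ) - (l + 1) = -l by ring] at this
    refine ⟨y, rfl, overwrite 0 (μ ++ [α]) y.1, ?_, ?_, ?_, centralWords_injective l ?_⟩
    · rwa [key, hv, shiftZ_mem_iff hΛ]
    · simpa using (List.append_inj_right' hv rfl)
    · rwa [key, hv, shift, shiftZ_mem_iff hΛ]
    · rw [h]
      change fittingWords Λ l (shiftZ ((l : ℤ) - 1)
        (splice (shiftZ (-(l : ℤ)) y.1) (-1) ((l : ℤ) + 1) _)) = _
      rw [key, hv, shift, fittingWords_overwrite_append hΛ _ hl]
      rfl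

theorem exists_minusRel {l : ℕ} {β : A} {μ : List A} {c' : Vq Λ (l + 1)}
    (h : β :: μ ∈ centralWords c') : ∃ c, minusRel Λ l β c' c := by
  obtain ⟨y, rfl⟩ := exists_vertexOf c'
  have hl : μ.length = l := by simpa using length_of_mem_centralWords h
  have hm : overwrite (-(l : ℤ)) (β :: μ) y.1 ∈ Λ := by
    have := h.2
    push_cast at this
    rwa [show (1 : ℤ) - (l + 1) = -l by ring] at this
  exact ⟨vertexOf l ⟨_, hm⟩, minusRel_iff.2 (fittingWords_overwrite_cons _ hl _)⟩

theorem exists_plusRel (hΛ : shiftMap '' Λ = Λ) {l : ℕ} {α : A} {μ : List A} {c' : Vq Λ (l + 1)}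
    (h : μ ++ [α] ∈ centralWords c') : ∃ c, plusRel Λ l α c c' := by
  obtain ⟨y, rfl⟩ := exists_vertexOf c'
  have hl : μ.length = l := by simpa using length_of_mem_centralWords h
  have hm : overwrite (-(l : ℤ)) (μ ++ [α]) y.1 ∈ Λ := by
    have := h.2
    push_cast at this
    rwa [show (1 : ℤ) - (l + 1) = -l by ring] at this
  exact ⟨vertexOf l ⟨_, (shiftZ_mem_iff hΛ (-1) _).2 hm⟩,
    (plusRel_iff hΛ).2 (fittingWords_overwrite_append hΛ _ hl _)⟩

theorem minusRel_vertexOf (l : ℕ) (x : ↥Λ) :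
    minusRel Λ l (x.1 (-(l : ℤ))) (vertexOf (l + 1) x) (vertexOf l x) := by
  rw [minusRel_iff, centralWords_vertexOf, centralWords_vertexOf,
    ← fittingWords_overwrite_cons _ (length_wordAt (-(l : ℤ) + 1) l x.1), ← wordAt_succ,
    overwrite_wordAt]

theorem plusRel_vertexOf (hΛ : shiftMap '' Λ = Λ) (l : ℕ) (x : ↥Λ) :
    plusRel Λ l (x.1 1) (vertexOf l x)
      (vertexOf (l + 1) ⟨shiftZ 1 x.1, (shiftZ_mem_iff hΛ 1 _).2 x.2⟩) := by
  have h := wordAt_succ_last (-(l : ℤ)) l (shiftZ 1 x.1)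
  have h1 : shiftZ 1 x.1 (-(l : ℤ) + l) = x.1 1 := by simp [shiftZ]
  have h2 : shiftZ (-1) (shiftZ 1 x.1) = x.1 := by
    funext n
    simp [shiftZ]
  rw [h1] at h
  rw [plusRel_iff hΛ, centralWords_vertexOf, centralWords_vertexOf,
    ← fittingWords_overwrite_append hΛ _ (length_wordAt (-(l : ℤ)) l (shiftZ 1 x.1)), ← h,
    overwrite_wordAt, h2]

theorem follower_canonicalLGBS (l : ℕ) (u : Vq Λ l) :
    follower (canonicalLGBS Λ) l u = centralWords u := by
  induction l with
  | zero => exact (centralWords_zero u).symm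
  | succ l ih =>
    ext w
    constructor
    · rintro ⟨⟨⟨c', β, c⟩, he⟩, rfl, w', hw', rfl⟩
      have h : w' ∈ centralWords c := ih c ▸ hw'
      rwa [minusRel_iff.1 he] at h
    · intro hw
      cases w with
      | nil => simpa using length_of_mem_centralWords hw
      | cons β μ =>
        obtain ⟨c, hc⟩ := exists_minusRel hw
        refine ⟨⟨(u, β, c), hc⟩, rfl, μ, ?_, rfl⟩
        change μ ∈ follower (canonicalLGBS Λ) l c
        rw [ih, minusRel_iff.1 hc]
        exact hw

theorem predecessor_canonicalLGBS (hΛ : shiftMap '' Λ = Λ) (l : ℕ) (u : Vq Λ l) :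
    predecessor (canonicalLGBS Λ) l u = centralWords u := by
  induction l with
  | zero => exact (centralWords_zero u).symm
  | succ l ih =>
    ext w
    constructor
    · rintro ⟨⟨⟨c, α, c'⟩, he⟩, rfl, w', hw', rfl⟩
      have h : w' ∈ centralWords c := ih c ▸ hw'
      rwa [(plusRel_iff hΛ).1 he] at h
    · intro hw
      rcases List.eq_nil_or_concat' w with rfl | ⟨μ, α, rfl⟩
      · simpa using length_of_mem_centralWords hw
      · obtain ⟨c, hc⟩ := exists_plusRel hΛ hw
        refine ⟨⟨(c, α, u), hc⟩, rfl, μ, ?_, rfl⟩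
        change μ ∈ predecessor (canonicalLGBS Λ) l c
        rw [ih, (plusRel_iff hΛ).1 hc]
        exact hw

theorem local_property_canonicalLGBS (hΛ : shiftMap '' Λ = Λ) (l : ℕ) (u : Vq Λ l)
    (v : Vq Λ (l + 2)) :
    let L := canonicalLGBS Λ
    ∃ φ : { p : L.Em l × L.Ep (l + 1) //
              L.tm l p.1 = u ∧ L.sm l p.1 = L.sp (l + 1) p.2 ∧ L.tp (l + 1) p.2 = v } ≃
          { q : L.Ep l × L.Em (l + 1) //
              L.sp l q.1 = u ∧ L.tp l q.1 = L.tm (l + 1) q.2 ∧ L.sm (l + 1) q.2 = v },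
      ∀ p, L.lm l p.1.1 = L.lm (l + 1) (φ p).1.2 ∧
        L.lp (l + 1) p.1.2 = L.lp l (φ p).1.1 := by
  intro L
  let T : Type := { r : A × A // centralWords u = { μ | r.1 :: (μ ++ [r.2]) ∈ centralWords v } }
  let f : { p : L.Em l × L.Ep (l + 1) //
      L.tm l p.1 = u ∧ L.sm l p.1 = L.sp (l + 1) p.2 ∧ L.tp (l + 1) p.2 = v } → T :=
    fun p => ⟨(L.lm l p.1.1, L.lp (l + 1) p.1.2), by
      obtain ⟨⟨⟨⟨a, β, b⟩, h⟩, ⟨⟨c, α, d⟩, h'⟩⟩, rfl, h₂, rfl⟩ := p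
      obtain rfl : a = c := h₂
      change centralWords b = { μ | β :: (μ ++ [α]) ∈ centralWords d }
      rw [minusRel_iff.1 h, (plusRel_iff hΛ).1 h']
      rfl⟩
  let g : { q : L.Ep l × L.Em (l + 1) //
      L.sp l q.1 = u ∧ L.tp l q.1 = L.tm (l + 1) q.2 ∧ L.sm (l + 1) q.2 = v } → T :=
    fun q => ⟨(L.lm (l + 1) q.1.2, L.lp l q.1.1), by
      obtain ⟨⟨⟨⟨a, α, b⟩, h⟩, ⟨⟨c, β, d⟩, h'⟩⟩, rfl, h₂, rfl⟩ := q
      obtain rfl : b = d := h₂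
      change centralWords a = { μ | β :: (μ ++ [α]) ∈ centralWords c }
      rw [(plusRel_iff hΛ).1 h, minusRel_iff.1 h']
      rfl⟩
  have hf : Function.Bijective f := by
    constructor
    · rintro ⟨⟨⟨⟨a, β, b⟩, h⟩, ⟨⟨c, α, d⟩, h'⟩⟩, rfl, h₂, rfl⟩
        ⟨⟨⟨⟨a', β', b'⟩, k⟩, ⟨⟨c', α', d'⟩, k'⟩⟩, h₃, h₄, h₅⟩ e
      obtain rfl : a = c := h₂
      obtain rfl : a' = c' := h₄
      obtain rfl : b' = b := h₃
      obtain rfl : d' = d := h₅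
      obtain ⟨rfl, rfl⟩ : β = β' ∧ α = α' := Prod.mk.inj (congrArg Subtype.val e)
      obtain rfl : a = a' := centralWords_injective _
        (((plusRel_iff hΛ).1 h').trans ((plusRel_iff hΛ).1 k').symm)
      rfl
    · rintro ⟨⟨β, α⟩, h⟩
      obtain ⟨μ, hμ⟩ := centralWords_nonempty u
      rw [h] at hμ
      obtain ⟨c, hc⟩ := exists_plusRel hΛ (μ := β :: μ) (α := α) (c' := v) hμ
      have hc' : minusRel Λ l β c u := by
        rw [minusRel_iff, (plusRel_iff hΛ).1 hc, h]
        rfl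
      exact ⟨⟨(⟨(c, β, u), hc'⟩, ⟨(c, α, v), hc⟩), rfl, rfl, rfl⟩, rfl⟩
  have hg : Function.Bijective g := by
    constructor
    · rintro ⟨⟨⟨⟨a, α, b⟩, h⟩, ⟨⟨c, β, d⟩, h'⟩⟩, rfl, h₂, rfl⟩
        ⟨⟨⟨⟨a', α', b'⟩, k⟩, ⟨⟨c', β', d'⟩, k'⟩⟩, h₃, h₄, h₅⟩ e
      obtain rfl : b = d := h₂
      obtain rfl : b' = d' := h₄
      obtain rfl : a' = a := h₃
      obtain rfl : c' = c := h₅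
      obtain ⟨rfl, rfl⟩ : β = β' ∧ α = α' := Prod.mk.inj (congrArg Subtype.val e)
      obtain rfl : b = b' := centralWords_injective _
        ((minusRel_iff.1 h').trans (minusRel_iff.1 k').symm)
      rfl
    · rintro ⟨⟨β, α⟩, h⟩
      obtain ⟨μ, hμ⟩ := centralWords_nonempty u
      rw [h] at hμ
      obtain ⟨c, hc⟩ := exists_minusRel (β := β) (μ := μ ++ [α]) (c' := v) hμ
      have hc' : plusRel Λ l α u c := by
        rw [plusRel_iff hΛ, minusRel_iff.1 hc, h]
        rfl
      exact ⟨⟨(⟨(u, α, c), hc'⟩, ⟨(v, β, c), hc⟩), rfl, rfl, rfl⟩, rfl⟩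
  refine ⟨(Equiv.ofBijective f hf).trans (Equiv.ofBijective g hg).symm, fun p => ?_⟩
  have e : g (((Equiv.ofBijective f hf).trans (Equiv.ofBijective g hg).symm) p) = f p :=
    (Equiv.ofBijective g hg).apply_symm_apply (f p)
  have e' := Prod.mk.inj (congrArg Subtype.val e)
  exact ⟨e'.1.symm, e'.2.symm⟩

theorem isLGBS_canonicalLGBS [Finite A] (hΛ : shiftMap '' Λ = Λ) (hne : Λ.Nonempty) :
    IsLGBS (canonicalLGBS Λ) := by
  have hfin (l : ℕ) : Finite (Vq Λ l) := by
    have h : {w : List A | w.length = l}.Finite := List.finite_length_eq A l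
    have := h.finite_subsets.to_subtype
    exact Finite.of_injective
      (fun c : Vq Λ l => (⟨centralWords c, fun _ hw => length_of_mem_centralWords hw⟩ :
        {s : Set (List A) | s ⊆ {w | w.length = l}}))
      fun c d h => centralWords_injective l (congrArg Subtype.val h)
  refine ⟨hfin, fun l => ⟨vertexOf l ⟨_, hne.some_mem⟩⟩, fun l => ?_, fun l => ?_,
    fun l c' => ?_, fun l c => ?_, fun l c => ?_, fun l c' => ?_, ?_, ?_,
    local_property_canonicalLGBS hΛ⟩
  · have := hfin l
    have := hfin (l + 1)
    exact Subtype.finite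
  · have := hfin l
    have := hfin (l + 1)
    exact Subtype.finite
  · obtain ⟨x, rfl⟩ := exists_vertexOf c'
    exact ⟨⟨(_, _, _), minusRel_vertexOf l x⟩, rfl⟩
  · obtain ⟨x, rfl⟩ := exists_vertexOf c
    exact ⟨⟨(_, _, _), minusRel_vertexOf l x⟩, rfl⟩
  · obtain ⟨x, rfl⟩ := exists_vertexOf c
    exact ⟨⟨(_, _, _), plusRel_vertexOf hΛ l x⟩, rfl⟩
  · obtain ⟨w, hw⟩ := centralWords_nonempty (l := l + 1) c'
    rcases List.eq_nil_or_concat' w with rfl | ⟨μ, α, rfl⟩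
    · simpa using length_of_mem_centralWords hw
    · obtain ⟨c, hc⟩ := exists_plusRel hΛ hw
      exact ⟨⟨(c, α, c'), hc⟩, rfl⟩
  · rintro l ⟨⟨a, β, b⟩, h⟩ ⟨⟨a', β', b'⟩, h'⟩ h₁ h₂
    obtain rfl : a = a' := h₁
    obtain rfl : β = β' := h₂
    obtain rfl : b = b' := centralWords_injective l
      ((minusRel_iff.1 h).trans (minusRel_iff.1 h').symm)
    rfl
  · rintro l ⟨⟨a, α, b⟩, h⟩ ⟨⟨a', α', b'⟩, h'⟩ h₁ h₂
    obtain rfl : b = b' := h₁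
    obtain rfl : α = α' := h₂
    obtain rfl : a = a' := centralWords_injective l
      (((plusRel_iff hΛ).1 h).trans ((plusRel_iff hΛ).1 h').symm)
    rfl

theorem mem_lang_of_append_mem_centralWords {l : ℕ} {c : Vq Λ l} {μ w ν : List A} (hw : w ≠ [])
    (h : μ ++ w ++ ν ∈ centralWords c) : w ∈ lang Λ := by
  obtain ⟨x, hx, i, e⟩ := exists_wordAt_of_mem_centralWords h
  refine ⟨hw, x, hx, i + μ.length, fun j => ?_⟩
  have h₁ : μ.length + (j : ℕ) < (μ ++ w ++ ν).length := by
    simp only [List.length_append]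
    omega
  have h₂ := List.getElem_of_eq e h₁
  simpa [wordAt, List.getElem_append, add_assoc] using h₂

theorem exists_append_mem_of_mem_wplusAux (hΛ : shiftMap '' Λ = Λ) {k n : ℕ} {u : Vq Λ n}
    {μ w : List A} (hw : w ∈ wplusAux (canonicalLGBS Λ) n k u) (hμ : μ ∈ centralWords u) :
    ∃ (m : ℕ) (c : Vq Λ m), μ ++ w ∈ centralWords c := by
  induction k generalizing n μ w with
  | zero =>
    obtain rfl : w = [] := hw
    exact ⟨n, u, by simpa using hμ⟩
  | succ k ih =>
    obtain ⟨⟨⟨c, α, c'⟩, he⟩, rfl, w', hw', rfl⟩ := hw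
    change μ ∈ centralWords c at hμ
    rw [(plusRel_iff hΛ).1 he] at hμ
    obtain ⟨m, d, hd⟩ := ih hw' hμ
    exact ⟨m, d, by rwa [List.append_assoc] at hd⟩

theorem exists_append_mem_of_mem_wminusAux {k n : ℕ} {u : Vq Λ (n + k)}
    {w : List A} (hw : w ∈ wminusAux (canonicalLGBS Λ) k n u) :
    ∃ ν, w ++ ν ∈ centralWords u := by
  induction k generalizing w with
  | zero =>
    obtain rfl : w = [] := hw
    exact centralWords_nonempty u
  | succ k ih =>
    obtain ⟨⟨⟨c', β, c⟩, he⟩, rfl, w', hw', rfl⟩ := hw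
    obtain ⟨ν, hν⟩ := ih hw'
    change w' ++ ν ∈ centralWords c at hν
    rw [minusRel_iff.1 he] at hν
    exact ⟨ν, hν⟩

theorem wordAt_mem_wplusAux (hΛ : shiftMap '' Λ = Λ) (n k : ℕ) (x : ↥Λ) :
    wordAt 1 k x.1 ∈ wplusAux (canonicalLGBS Λ) n k (vertexOf n x) := by
  induction k generalizing n x with
  | zero => rfl
  | succ k ih =>
    refine ⟨⟨(_, _, _), plusRel_vertexOf hΛ n x⟩, rfl, _, ih _ _, ?_⟩
    rw [wordAt_succ]
    exact congrArg _ (List.map_congr_left fun j _ => congrArg x.1 (add_right_comm _ _ _))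

theorem wordAt_mem_wminusAux (n k : ℕ) (x : ↥Λ) :
    wordAt (1 - ((n + k : ℕ) : ℤ)) k x.1 ∈
      wminusAux (canonicalLGBS Λ) k n (vertexOf (n + k) x) := by
  induction k with
  | zero => rfl
  | succ k ih =>
    refine ⟨⟨(_, _, _), minusRel_vertexOf (n + k) x⟩, rfl, _, ih, ?_⟩
    rw [wordAt_succ]
    have e : (1 : ℤ) - ((n + (k + 1) : ℕ) : ℤ) = -((n + k : ℕ) : ℤ) := by push_cast; ring
    rw [e, show -((n + k : ℕ) : ℤ) + 1 = 1 - ((n + k : ℕ) : ℤ) by ring]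
    rfl

theorem exists_eq_wordAt_of_mem_lang (hΛ : shiftMap '' Λ = Λ) {w : List A} (hw : w ∈ lang Λ)
    (i : ℤ) : ∃ x : ↥Λ, w = wordAt i w.length x.1 := by
  obtain ⟨-, x, hx, j, h⟩ := hw
  refine ⟨⟨shiftZ (j - i) x, (shiftZ_mem_iff hΛ _ _).2 hx⟩, eq_wordAt fun m => ?_⟩
  rw [h]
  simp only [shiftZ]
  congr 1
  ring

theorem wPlus_canonicalLGBS (hΛ : shiftMap '' Λ = Λ) : wPlus (canonicalLGBS Λ) = lang Λ := by
  ext w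
  constructor
  · rintro ⟨hw, n, u, h⟩
    obtain ⟨μ, hμ⟩ := centralWords_nonempty (l := n) u
    obtain ⟨m, c, hc⟩ := exists_append_mem_of_mem_wplusAux hΛ h hμ
    exact mem_lang_of_append_mem_centralWords (ν := []) hw (by simpa using hc)
  · intro h
    obtain ⟨x, hx⟩ := exists_eq_wordAt_of_mem_lang hΛ h 1
    refine ⟨h.1, 0, vertexOf 0 x, ?_⟩
    have := wordAt_mem_wplusAux hΛ 0 w.length x
    rwa [← hx] at this

theorem wMinus_canonicalLGBS (hΛ : shiftMap '' Λ = Λ) : wMinus (canonicalLGBS Λ) = lang Λ := by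
  ext w
  constructor
  · rintro ⟨hw, n, u, h⟩
    obtain ⟨ν, hν⟩ := exists_append_mem_of_mem_wminusAux h
    exact mem_lang_of_append_mem_centralWords (μ := []) hw (by simpa using hν)
  · intro h
    obtain ⟨x, hx⟩ := exists_eq_wordAt_of_mem_lang hΛ h (1 - ((0 + w.length : ℕ) : ℤ))
    refine ⟨h.1, 0, vertexOf (0 + w.length) x, ?_⟩
    have := wordAt_mem_wminusAux 0 w.length x
    rwa [← hx] at this

end classes

/-- the canonical pair built from the central equivalence classes of a
nonempty subshift `Λ` is a λ-graph bisystem over the common alphabet, satisfies FPCC,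
and presents `Λ`: its word sets coincide with the admissible words of `Λ`. -/
theorem stmt_4 {A : Type} [Finite A] [TopologicalSpace A] [DiscreteTopology A]
    (Λ : Set (ℤ → A)) (hΛ : IsSubshift Λ) (hne : Λ.Nonempty) :
    IsLGBS (canonicalLGBS Λ) ∧ (canonicalLGBS Λ).FPCC ∧
      wPlus (canonicalLGBS Λ) = lang Λ ∧ wMinus (canonicalLGBS Λ) = lang Λ := by
  refine ⟨isLGBS_canonicalLGBS hΛ.2 hne, ⟨⟨⟨vertexOf 0 ⟨_, hne.some_mem⟩⟩, ⟨fun c d => ?_⟩⟩,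
    fun l u => ?_⟩, wPlus_canonicalLGBS hΛ.2, wMinus_canonicalLGBS hΛ.2⟩
  · exact centralWords_injective 0 ((centralWords_zero c).trans (centralWords_zero d).symm)
  · exact (follower_canonicalLGBS l u).trans (predecessor_canonicalLGBS hΛ.2 l u).symm
end

section
/- Properly strong shift equivalence is an equivalence relation on the class of symbolic matrix bisystems satisfying FPCC; in particular it is reflexive: every symbolic matrix bisystem satisfying FPCC is properly strong shift equivalent in 1-step to itself. -/
/-- Product of two symbolic matrices: the entries of the product of a symbolic matrix
over `C` and a symbolic matrix over `D` are formal sums (multisets) of two-letter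
words in `C·D`. -/
def symMul {I J K C D : Type} [Fintype J]
    (A : I → J → Multiset C) (B : J → K → Multiset D) : I → K → Multiset (C × D) :=
  fun i k => ∑ j : J, (A i j).bind fun a => (B j k).map fun b => (a, b)
/-- The underlying data of a symbolic matrix bisystem: sequences of `m l × m (l+1)`
symbolic matrices (entries are formal sums, i.e. multisets, of symbols). -/
structure SMBData (Sm Sp : Type) where
  m : ℕ → ℕ
  Mm : ∀ l, Fin (m l) → Fin (m (l + 1)) → Multiset Sm
  Mp : ∀ l, Fin (m l) → Fin (m (l + 1)) → Multiset Sp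

/-- The axioms making the data `M` a symbolic matrix bisystem: nonzero rows and
columns, no repeated symbol in an entry, no symbol repeated across the rows of a
column (right/left resolving), and the κ-commutation relation
`M⁻_{l,l+1} M⁺_{l+1,l+2} ≃_κ M⁺_{l,l+1} M⁻_{l+1,l+2}`. -/
structure IsSMB {Sm Sp : Type} (M : SMBData Sm Sp) : Prop where
  mpos : ∀ l, 0 < M.m l
  row_m : ∀ l i, ∃ j, M.Mm l i j ≠ 0
  col_m : ∀ l j, ∃ i, M.Mm l i j ≠ 0
  row_p : ∀ l i, ∃ j, M.Mp l i j ≠ 0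
  col_p : ∀ l j, ∃ i, M.Mp l i j ≠ 0
  nodup_m : ∀ l i j, (M.Mm l i j).Nodup
  nodup_p : ∀ l i j, (M.Mp l i j).Nodup
  res_m : ∀ l j i i' a, a ∈ M.Mm l i j → a ∈ M.Mm l i' j → i = i'
  res_p : ∀ l j i i' a, a ∈ M.Mp l i j → a ∈ M.Mp l i' j → i = i'
  commute : ∀ l i j,
    (symMul (M.Mm l) (M.Mp (l + 1)) i j).map Prod.swap = symMul (M.Mp l) (M.Mm (l + 1)) i j

/-- Entries of the product of `k` consecutive symbolic matrices starting at level `n`: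
formal sums of words of length `k`. -/
def prodFrom {S : Type} {m : ℕ → ℕ}
    (M : ∀ l, Fin (m l) → Fin (m (l + 1)) → Multiset S) (n : ℕ) :
    (k : ℕ) → Fin (m n) → Fin (m (n + k)) → Multiset (List S)
  | 0, i, j => if i = j then {[]} else 0
  | k + 1, i, j =>
      ∑ p : Fin (m (n + k)),
        (prodFrom M n k i p).bind fun w => (M (n + k) p j).map fun a => w ++ [a]

/-- FPCC for a symbolic matrix bisystem over a common alphabet: it is standard
(`m 0 = 1`) and for every `l ≥ 1` the words appearing in the `(1,j)` entry of
`M⁻_{0,1}⋯M⁻_{l-1,l}` are exactly the reversed words appearing in the `(1,j)` entry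
of `M⁺_{0,1}⋯M⁺_{l-1,l}`. -/
def SMBData.FPCC {S : Type} (M : SMBData S S) : Prop :=
  M.m 0 = 1 ∧
  ∀ l : ℕ, 1 ≤ l → ∀ (i : Fin (M.m 0)) (j : Fin (M.m (0 + l))) (w : List S),
    w ∈ prodFrom M.Mm 0 l i j ↔ w.reverse ∈ prodFrom M.Mp 0 l i j

/-- The set of nonempty admissible words of the presenting subshift of a symbolic
matrix bisystem: the words appearing as entries of products
`M⁺_{l,l+1} M⁺_{l+1,l+2} ⋯ M⁺_{l+k-1,l+k}`. -/
def smbWords {S : Type} (M : SMBData S S) : Set (List S) :=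
  { w | w ≠ [] ∧ ∃ (n k : ℕ) (i : Fin (M.m n)) (j : Fin (M.m (n + k))),
      w ∈ prodFrom M.Mp n k i j }
/-- The data of a properly strong shift equivalence in 1-step between two symbolic
matrix bisystems `M` (over `Σ_M`) and `N` (over `Σ_N`), with alphabets `C, D`,
specifications `φ : Σ_M → C·D`, `ψ : Σ_N → D·C`, and matrices `P_l` over `C`, `Q_l`
over `D`, `X_l` over `D` and `Y_l` over `C` (the parity-dependent families `X, Y`
are recorded as `Xe l = X_{2l}`, `Xo l = X_{2l+1}`, `Ye l = Y_{2l}`, `Yo l = Y_{2l+1}`),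
subject to the defining specified equivalences. -/
structure PSSE1Data (C D : Type) {SM SN : Type} (M : SMBData SM SM) (N : SMBData SN SN) where
  φ : SM → C × D
  ψ : SN → D × C
  φ_inj : Function.Injective φ
  ψ_inj : Function.Injective ψ
  c : ℕ → ℕ
  d : ℕ → ℕ
  hc : ∀ l, c (2 * l) = M.m l
  hd : ∀ l, d (2 * l) = N.m l
  P : ∀ l, Fin (c l) → Fin (d (l + 1)) → Multiset C
  Q : ∀ l, Fin (d l) → Fin (c (l + 1)) → Multiset D
  Xe : ∀ l, Fin (c (2 * l)) → Fin (c (2 * l + 1)) → Multiset D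
  Xo : ∀ l, Fin (d (2 * l + 1)) → Fin (d (2 * l + 2)) → Multiset D
  Ye : ∀ l, Fin (d (2 * l)) → Fin (d (2 * l + 1)) → Multiset C
  Yo : ∀ l, Fin (c (2 * l + 1)) → Fin (c (2 * l + 2)) → Multiset C
  hMp : ∀ l i j, (M.Mp l i j).map φ =
    symMul (P (2 * l)) (Q (2 * l + 1)) (Fin.cast (hc l).symm i) (Fin.cast (hc (l + 1)).symm j)
  hNp : ∀ l i j, (N.Mp l i j).map ψ =
    symMul (Q (2 * l)) (P (2 * l + 1)) (Fin.cast (hd l).symm i) (Fin.cast (hd (l + 1)).symm j)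
  hMm : ∀ l i j, (M.Mm l i j).map (Prod.swap ∘ φ) =
    symMul (Xe l) (Yo l) (Fin.cast (hc l).symm i) (Fin.cast (hc (l + 1)).symm j)
  hNm : ∀ l i j, (N.Mm l i j).map (Prod.swap ∘ ψ) =
    symMul (Ye l) (Xo l) (Fin.cast (hd l).symm i) (Fin.cast (hd (l + 1)).symm j)
  hYP : ∀ l i j, (symMul (Yo l) (P (2 * l + 2)) i j).map Prod.swap =
    symMul (P (2 * l + 1)) (Ye (l + 1)) i j
  hXQ : ∀ l i j, (symMul (Xo l) (Q (2 * l + 2)) i j).map Prod.swap =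
    symMul (Q (2 * l + 1)) (Xe (l + 1)) i j
  hXP : ∀ l i j, (symMul (Xe l) (P (2 * l + 1)) i j).map Prod.swap =
    symMul (P (2 * l)) (Xo l) i j
  hYQ : ∀ l i j, (symMul (Ye l) (Q (2 * l + 1)) i j).map Prod.swap =
    symMul (Q (2 * l)) (Yo l) i j

/-- Properly strong shift equivalence in 1-step. -/
def PSSE1 {SM SN : Type} (M : SMBData SM SM) (N : SMBData SN SN) : Prop :=
  ∃ C D : Type, Nonempty (PSSE1Data C D M N)
/-- A symbolic matrix bisystem over a common alphabet, satisfying FPCC (bundled). -/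
structure SMBBundle : Type 1 where
  carrier : Type
  data : SMBData carrier carrier
  isSMB : IsSMB data
  fpcc : data.FPCC

/-- Properly strong shift equivalence: a finite chain of symbolic matrix bisystems
each consecutive pair of which is properly strong shift equivalent in 1-step. -/
def ProperlySSE (b b' : SMBBundle) : Prop :=
  Relation.ReflTransGen (fun u v : SMBBundle => PSSE1 u.data v.data) b b'

/-- The identity symbolic matrix over the one-letter alphabet, between index sets of
possibly only propositionally equal size. -/
def idMat (a b : ℕ) : Fin a → Fin b → Multiset Unit :=
  fun i j => if i.val = j.val then {()} else 0

theorem symMul_idMat_left {a b : ℕ} {K S : Type} (h : a = b) (B : Fin b → K → Multiset S)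
    (i : Fin a) (k : K) :
    symMul (idMat a b) B i k = (B (Fin.cast h i) k).map fun s => ((), s) := by
  subst h
  simp only [symMul, idMat]
  rw [Finset.sum_eq_single i]
  · simp
  · intro j _ hj
    simp [Fin.val_inj, hj.symm]
  · simp

theorem symMul_idMat_right {b c : ℕ} {I S : Type} (h : c = b) (A : I → Fin b → Multiset S)
    (i : I) (k : Fin c) :
    symMul A (idMat b c) i k = (A i (Fin.cast h k)).map fun s => (s, ()) := by
  subst h
  simp only [symMul, idMat]
  rw [Finset.sum_eq_single k]
  · simp [Multiset.bind_singleton]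
  · intro j _ hj
    simp [Fin.val_inj, hj]
  · simp

/-- The matrix `A n` of a sequence of symbolic matrices, reindexed along equalities of
levels. -/
def castMat {S : Type} {m : ℕ → ℕ} (A : ∀ l, Fin (m l) → Fin (m (l + 1)) → Multiset S)
    (n : ℕ) {p q : ℕ} (hp : p = n) (hq : q = n + 1) : Fin (m p) → Fin (m q) → Multiset S :=
  fun i j => A n (Fin.cast (congrArg m hp) i) (Fin.cast (congrArg m hq) j)

theorem castMat_eq {S : Type} {m : ℕ → ℕ}
    (A : ∀ l, Fin (m l) → Fin (m (l + 1)) → Multiset S)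
    {n n' p q : ℕ} (hp : p = n) (hq : q = n + 1) (hn : n = n') (i : Fin (m p)) (j : Fin (m q)) :
    castMat A n hp hq i j =
      A n' (Fin.cast (congrArg m (hp.trans hn)) i)
        (Fin.cast (congrArg m (hq.trans (congrArg (· + 1) hn))) j) := by
  subst hn
  rfl

theorem symMul_castMat {S T : Type} {m : ℕ → ℕ}
    (A : ∀ l, Fin (m l) → Fin (m (l + 1)) → Multiset S)
    (B : ∀ l, Fin (m l) → Fin (m (l + 1)) → Multiset T)
    {n n' l p q r : ℕ} (hp : p = n) (hq : q = n + 1) (hq' : q = n') (hr : r = n' + 1)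
    (hn : n = l) (i : Fin (m p)) (k : Fin (m r)) :
    symMul (castMat A n hp hq) (castMat B n' hq' hr) i k =
      symMul (A l) (B (l + 1)) (Fin.cast (congrArg m (hp.trans hn)) i)
        (Fin.cast (congrArg m (by omega)) k) := by
  subst hn hp hq hq' hr
  rfl

/-- Every symbolic matrix bisystem is properly strong shift equivalent in 1-step to
itself, via the factorizations `M⁺ = M⁺ · I = I · M⁺` and `M⁻ = I · M⁻ = M⁻ · I`. -/
theorem PSSE1.refl {S : Type} (M : SMBData S S) (hM : IsSMB M) : PSSE1 M M := by
  refine ⟨S, Unit, ⟨{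
    φ := fun a => (a, ())
    ψ := fun a => ((), a)
    φ_inj := fun a b h => congrArg Prod.fst h
    ψ_inj := fun a b h => congrArg Prod.snd h
    c := fun l => M.m (l / 2)
    d := fun l => M.m ((l + 1) / 2)
    hc := fun l => congrArg M.m (by omega)
    hd := fun l => congrArg M.m (by omega)
    P := fun l => castMat M.Mp (l / 2) rfl (by omega)
    Q := fun l => idMat _ _
    Xe := fun l => idMat _ _
    Xo := fun l => idMat _ _
    Ye := fun l => castMat M.Mm l (by omega) (by omega)
    Yo := fun l => castMat M.Mm l (by omega) (by omega)
    hMp := ?_, hNp := ?_, hMm := ?_, hNm := ?_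
    hYP := ?_, hXQ := ?_, hXP := ?_, hYQ := ?_ }⟩⟩
  · intro l i j
    rw [symMul_idMat_right (congrArg M.m (by omega)), castMat_eq _ _ _ (n' := l) (by omega)]
    rfl
  · intro l i j
    rw [symMul_idMat_left (congrArg M.m (by omega)), castMat_eq _ _ _ (n' := l) (by omega)]
    rfl
  · intro l i j
    rw [symMul_idMat_left (congrArg M.m (by omega)), castMat_eq _ _ _ (n' := l) rfl]
    rfl
  · intro l i j
    rw [symMul_idMat_right (congrArg M.m (by omega)), castMat_eq _ _ _ (n' := l) rfl]
    rfl
  · intro l i j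
    rw [symMul_castMat (l := l) (hn := rfl), symMul_castMat (l := l) (hn := by omega)]
    exact hM.commute l _ _
  · intro l i j
    rw [symMul_idMat_left (congrArg M.m (by omega)), symMul_idMat_left (congrArg M.m (by omega)),
      Multiset.map_map]
    simp [idMat]
  · intro l i j
    rw [symMul_idMat_left (congrArg M.m (by omega)), symMul_idMat_right (congrArg M.m (by omega)),
      castMat_eq _ _ _ (n' := l) (by omega), castMat_eq _ _ _ (n' := l) (by omega),
      Multiset.map_map]
    rfl
  · intro l i j
    rw [symMul_idMat_right (congrArg M.m (by omega)), symMul_idMat_left (congrArg M.m (by omega)),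
      Multiset.map_map]
    rfl

/-- Interchanging the roles of `C` and `D`, of `P` and `Q` and of `X` and `Y` reverses a
properly strong shift equivalence in 1-step. -/
def PSSE1Data.symm {C D SM SN : Type} {M : SMBData SM SM} {N : SMBData SN SN}
    (E : PSSE1Data C D M N) : PSSE1Data D C N M where
  φ := E.ψ
  ψ := E.φ
  φ_inj := E.ψ_inj
  ψ_inj := E.φ_inj
  c := E.d
  d := E.c
  hc := E.hd
  hd := E.hc
  P := E.Q
  Q := E.P
  Xe := E.Ye
  Xo := E.Yo
  Ye := E.Xe
  Yo := E.Xo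
  hMp := E.hNp
  hNp := E.hMp
  hMm := E.hNm
  hNm := E.hMm
  hYP := E.hXQ
  hXQ := E.hYP
  hXP := E.hYQ
  hYQ := E.hXP

theorem PSSE1.symm {SM SN : Type} {M : SMBData SM SM} {N : SMBData SN SN} (h : PSSE1 M N) :
    PSSE1 N M := by
  obtain ⟨C, D, ⟨E⟩⟩ := h
  exact ⟨D, C, ⟨E.symm⟩⟩

/-- properly strong shift equivalence is an equivalence relation on the
class of symbolic matrix bisystems satisfying FPCC; in particular every such bisystem
is properly strong shift equivalent in 1-step to itself. -/
theorem stmt_5 :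
    (∀ b : SMBBundle, PSSE1 b.data b.data) ∧ Equivalence ProperlySSE := by
  refine ⟨fun b => PSSE1.refl b.data b.isSMB, fun _ => Relation.ReflTransGen.refl, ?_,
    fun h₁ h₂ => Relation.ReflTransGen.trans h₁ h₂⟩
  intro b b' h
  induction h with
  | refl => exact Relation.ReflTransGen.refl
  | tail _ hbc ih => exact Relation.ReflTransGen.head hbc.symm ih
end
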